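/- Let 𝟙 = (1,…,1) ∈ (ℤ/2ℤ)^r be the all-ones row vector, r ≥ 3. Then the stabilizer S(𝟙) = {M ∈ GL_r(ℤ/2ℤ) : 𝟙·M = 𝟙} is generated by the double elementary matrices X_{ik}·X_{jk} for pairwise distinct i,j,k, i.e., matrices with ones on the diagonal and in the two positions (i,k) and (j,k), and zeros elsewhere. -/

import Mathlib

/-- The elementary matrix `X i j` over `ℤ/2ℤ`: identity plus an extra 1 in position (i,j). -/
def X {r : ℕ} (i j : Fin r) (h : i ≠ j) : Matrix.SpecialLinearGroup (Fin r) (ZMod 2) :=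
  ⟨Matrix.transvection i j 1, Matrix.det_transvection_of_ne i j h 1⟩

/-- The stabilizer of the row vector `v` in `GL_r(ℤ/2ℤ)` under right multiplication. -/
def S {r : ℕ} (v : Fin r → ZMod 2) : Subgroup (GL (Fin r) (ZMod 2)) where
  carrier := {M | Matrix.vecMul v (M : Matrix (Fin r) (Fin r) (ZMod 2)) = v}
  one_mem' := by simp
  mul_mem' := by
    intro a b ha hb
    simp only [Set.mem_setOf_eq] at *
    rw [Units.val_mul, ← Matrix.vecMul_vecMul, ha, hb]
  inv_mem' := by
    intro a ha
    simp only [Set.mem_setOf_eq] at *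
    conv_lhs => rw [← ha, Matrix.vecMul_vecMul, ← Units.val_mul, mul_inv_cancel,
      Units.val_one, Matrix.vecMul_one]

/-- The group generated by the double elementary matrices. -/
def dblH (r : ℕ) : Subgroup (GL (Fin r) (ZMod 2)) :=
  Subgroup.closure
      {A | ∃ i j k : Fin r, ∃ hik : i ≠ k, ∃ hjk : j ≠ k, i ≠ j ∧
        A = (X i k hik * X j k hjk).toGL}

/-- The map `v ↦ v + v k • w`. -/
def tvec {r : ℕ} (k : Fin r) (w : Fin r → ZMod 2) : Matrix (Fin r) (Fin r) (ZMod 2) :=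
  1 + Matrix.vecMulVec w (Pi.single k 1)

lemma tvec_mul {r : ℕ} (k : Fin r) (w w' : Fin r → ZMod 2) (h : w' k = 0) :
    tvec k w * tvec k w' = tvec k (w + w') := by
  have : Matrix.vecMulVec w (Pi.single k 1) * Matrix.vecMulVec w' (Pi.single k (1 : ZMod 2)) = 0 := by
    rw [Matrix.vecMulVec_mul_vecMulVec]
    simp [h]
  simp only [tvec, mul_add, add_mul, this, Matrix.add_vecMulVec]
  simp only [mul_one, one_mul, add_zero]
  abel

lemma tvec_mulVec {r : ℕ} (k : Fin r) (w v : Fin r → ZMod 2) :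
    (tvec k w).mulVec v = v + v k • w := by
  ext i
  simp [tvec, Matrix.add_mulVec, Matrix.vecMulVec_mulVec, mul_comm]

lemma transv_eq {r : ℕ} (i k : Fin r) : Matrix.transvection i k (1 : ZMod 2) = tvec k (Pi.single i 1) := by
  ext a b
  simp [tvec, Matrix.transvection, Matrix.vecMulVec_apply, Matrix.single_apply, Pi.single_apply]
  grind

lemma gen_eq {r : ℕ} (i j k : Fin r) (hik : i ≠ k) (hjk : j ≠ k) :
    (((X i k hik * X j k hjk).toGL : GL (Fin r) (ZMod 2)) : Matrix (Fin r) (Fin r) (ZMod 2))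
      = tvec k (Pi.single i 1 + Pi.single j 1) := by
  rw [← tvec_mul _ _ _ (by simp [hjk.symm]), ← transv_eq, ← transv_eq]
  rfl

lemma zmod2_cases (a : ZMod 2) : a = 0 ∨ a = 1 := by
  revert a; decide

lemma zmod2_add_self (a : ZMod 2) : a + a = 0 := by
  revert a; decide

lemma tvec_zero {r : ℕ} (k : Fin r) : tvec k 0 = 1 := by simp [tvec]

lemma tvec_sum_mem {r : ℕ} (k : Fin r) (f : Fin r → Fin r → ZMod 2) (hk : ∀ i, f i k = 0)
    (h : ∀ i, ∃ g ∈ dblH r, (g : Matrix (Fin r) (Fin r) (ZMod 2)) = tvec k (f i))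
    (s : Finset (Fin r)) :
    ∃ g ∈ dblH r, (g : Matrix (Fin r) (Fin r) (ZMod 2)) = tvec k (∑ i ∈ s, f i) := by
  induction s using Finset.induction_on with
  | empty => exact ⟨1, one_mem _, by simp [tvec_zero]⟩
  | insert a s ha ih =>
    obtain ⟨g, hg, hge⟩ := ih
    obtain ⟨g', hg', hge'⟩ := h a
    refine ⟨g' * g, mul_mem hg' hg, ?_⟩
    rw [Units.val_mul, hge, hge', tvec_mul _ _ _ (by simp [hk]), Finset.sum_insert ha]

lemma exists_third {r : ℕ} (hr : 3 ≤ r) (a b : Fin r) : ∃ j, j ≠ a ∧ j ≠ b := by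
  have : ∃ j ∈ (Finset.univ : Finset (Fin r)), j ∉ ({a, b} : Finset (Fin r)) := by
    apply Finset.exists_mem_notMem_of_card_lt_card
    have := Finset.card_le_two (a := a) (b := b)
    simp
    omega
  obtain ⟨j, -, hj⟩ := this
  exact ⟨j, by simpa using hj⟩

lemma tvec_mem {r : ℕ} (hr : 3 ≤ r) (k : Fin r) (w : Fin r → ZMod 2) (hk : w k = 0)
    (hs : ∑ i, w i = 0) :
    ∃ g ∈ dblH r, (g : Matrix (Fin r) (Fin r) (ZMod 2)) = tvec k w := by
  obtain ⟨j, hj, -⟩ := exists_third hr k k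
  have key := tvec_sum_mem k (fun i => w i • (Pi.single i 1 + Pi.single j 1)) ?_ ?_ Finset.univ
  · have e : (∑ i, w i • (Pi.single i 1 + Pi.single j 1 : Fin r → ZMod 2)) = w := by
      simp only [smul_add, Finset.sum_add_distrib, ← Finset.sum_smul, hs, zero_smul, add_zero]
      ext l
      simp [Finset.sum_apply, Pi.single_apply]
    rwa [e] at key
  · intro i
    by_cases hi : i = k
    · subst hi; simp [hk]
    · simp [Ne.symm hi, hj.symm]
  · intro i
    by_cases hij : i = j
    · refine ⟨1, one_mem _, ?_⟩
      have : (Pi.single i 1 + Pi.single j 1 : Fin r → ZMod 2) = 0 := by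
        subst hij; ext l; exact zmod2_add_self _
      simp [this, tvec_zero]
    · rcases zmod2_cases (w i) with h | h
      · exact ⟨1, one_mem _, by simp [h, tvec_zero]⟩
      · have hik : i ≠ k := by rintro rfl; simp [hk] at h
        refine ⟨_, Subgroup.subset_closure ⟨i, j, k, hik, hj, hij, rfl⟩, ?_⟩
        rw [gen_eq]; simp [h]

lemma dblH_le (r : ℕ) : dblH r ≤ S (fun _ => (1 : ZMod 2)) := by
  refine (Subgroup.closure_le _).2 ?_
  rintro A ⟨i, j, k, hik, hjk, hij, rfl⟩
  show Matrix.vecMul _ _ = _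
  rw [gen_eq, tvec, Matrix.vecMul_add, Matrix.vecMul_vecMulVec]
  have : (fun _ => (1 : ZMod 2)) ⬝ᵥ (Pi.single i 1 + Pi.single j 1 : Fin r → ZMod 2) = 0 := by
    simp [dotProduct_add]; decide
  simp [this]

lemma col_sum {r : ℕ} {M : GL (Fin r) (ZMod 2)} (hM : M ∈ S (fun _ => (1 : ZMod 2))) (k : Fin r) :
    ∑ i, M.val i k = 1 := by
  have h : Matrix.vecMul (fun _ => (1 : ZMod 2)) M.val = fun _ => 1 := hM
  have := congrFun h k
  simpa [Matrix.vecMul, dotProduct] using this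

lemma mul_col {r : ℕ} {A B : Matrix (Fin r) (Fin r) (ZMod 2)} (j : Fin r) :
    (A * B).col j = A.mulVec (B.col j) := by
  ext i; rfl

/-- `M` fixes the first `m` basis vectors. -/
def Fixes {r : ℕ} (m : ℕ) (M : GL (Fin r) (ZMod 2)) : Prop :=
  ∀ i : Fin r, i.val < m → M.val.col i = Pi.single i 1

lemma fixes_mul {r : ℕ} {m : ℕ} {g M : GL (Fin r) (ZMod 2)} {k : Fin r} {w : Fin r → ZMod 2}
    (hg : g.val = tvec k w) (hk : m ≤ k.val) (hM : Fixes m M) : Fixes m (g * M) := by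
  intro i hi
  rw [Units.val_mul, mul_col, hM i hi, hg, tvec_mulVec]
  have : k ≠ i := by rintro rfl; omega
  simp [this]

lemma exists_nz {r : ℕ} {M : GL (Fin r) (ZMod 2)} (k : Fin r) (hM : Fixes k.val M) :
    ∃ l : Fin r, k ≤ l ∧ M.val l k = 1 := by
  by_contra! hc
  have h0 : ∀ l : Fin r, k ≤ l → M.val l k = 0 := fun l hl =>
    (zmod2_cases _).resolve_right (hc l hl)
  have h1 : M.val.mulVec (M.val.col k) = M.val.col k := by
    ext a
    have : ∀ i, M.val a i * M.val i k = (1 : Matrix (Fin r) (Fin r) (ZMod 2)) a i * M.val i k := by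
      intro i
      by_cases hi : k ≤ i
      · simp [h0 i hi]
      · have := congrFun (hM i (by simpa using hi)) a
        simp only [Matrix.col_apply] at this
        rw [this, Matrix.one_apply, Pi.single_apply]
    show ∑ i, M.val a i * M.val i k = M.val a k
    rw [Finset.sum_congr rfl (fun i _ => this i)]
    simp [Matrix.one_apply]
  have h2 : M.val.mulVec (M.val.col k) = M.val.mulVec (Pi.single k 1) := by
    rw [h1]; ext a; simp
  have h3 := Matrix.mulVec_injective_of_isUnit M.isUnit h2
  have h4 := congrFun h3 k
  have h5 := h0 k le_rfl
  simp [h5] at h4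

lemma step_one {r : ℕ} (hr : 3 ≤ r) {M : GL (Fin r) (ZMod 2)} (k : Fin r) (hM : Fixes k.val M) :
    ∃ g ∈ dblH r, Fixes k.val (g * M) ∧ (g * M).val k k = 1 := by
  obtain ⟨l, hl, hlk⟩ := exists_nz k hM
  rcases zmod2_cases (M.val k k) with h | h
  · have hkl : k ≠ l := by rintro rfl; simp [h] at hlk
    obtain ⟨j, hjk, hjl⟩ := exists_third hr k l
    obtain ⟨g, hg, hge⟩ := tvec_mem hr l (Pi.single k 1 + Pi.single j 1)
      (by simp [hkl.symm, hjl.symm]) (by simp [Finset.sum_add_distrib]; decide)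
    refine ⟨g, hg, fixes_mul hge hl hM, ?_⟩
    have : (g * M).val.col k k = 1 := by
      rw [Units.val_mul, mul_col, hge, tvec_mulVec]
      simp [h, hlk, hjk.symm]
    exact this
  · exact ⟨1, one_mem _, by simpa using hM, by simpa using h⟩

lemma step_two {r : ℕ} (hr : 3 ≤ r) {M : GL (Fin r) (ZMod 2)} (hS : M ∈ S (fun _ => (1 : ZMod 2)))
    (k : Fin r) (hM : Fixes k.val M) (hk : M.val k k = 1) :
    ∃ g ∈ dblH r, Fixes (k.val + 1) (g * M) := by
  obtain ⟨g, hg, hge⟩ := tvec_mem hr k (M.val.col k + Pi.single k 1)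
    (by simp [hk]; decide) (by simp [Finset.sum_add_distrib, col_sum hS]; decide)
  refine ⟨g, hg, ?_⟩
  intro i hi
  by_cases hik : i = k
  · subst hik
    rw [Units.val_mul, mul_col, hge, tvec_mulVec]
    rw [Matrix.col_apply, hk, one_smul, ← add_assoc]
    ext a
    simp [zmod2_add_self]
  · exact fixes_mul hge le_rfl hM i (by have : i.val ≠ k.val := fun h => hik (Fin.ext h)
                                        omega)

lemma main_aux {r : ℕ} (hr : 3 ≤ r) (d : ℕ) : ∀ m : ℕ, m + d = r → ∀ M : GL (Fin r) (ZMod 2),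
    M ∈ S (fun _ => (1 : ZMod 2)) → Fixes m M → M ∈ dblH r := by
  induction d with
  | zero =>
    intro m hm M _ hM
    have : M = 1 := by
      ext a b
      have := congrFun (hM b (by omega)) a
      rw [Matrix.col_apply] at this
      rw [this, Units.val_one, Matrix.one_apply, Pi.single_apply]
    rw [this]; exact one_mem _
  | succ d ih =>
    intro m hm M hS hM
    obtain ⟨g, hg, hF, h1⟩ := step_one hr (⟨m, by omega⟩ : Fin r) hM
    have hS' := mul_mem (dblH_le r hg) hS
    obtain ⟨g', hg', hF'⟩ := step_two hr hS' _ hF h1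
    have := ih (m + 1) (by omega) _ (mul_mem (dblH_le r hg') hS') hF'
    rwa [Subgroup.mul_mem_cancel_left _ hg', Subgroup.mul_mem_cancel_left _ hg] at this

theorem stabilizer_of_all_ones_generated_by_double_elementary (r : ℕ) (hr : 3 ≤ r) :
    Subgroup.closure
      {A | ∃ i j k : Fin r, ∃ hik : i ≠ k, ∃ hjk : j ≠ k, i ≠ j ∧
        A = (X i k hik * X j k hjk).toGL} =
      S (fun _ => (1 : ZMod 2)) := by
  apply le_antisymm (dblH_le r)
  intro M hM
  exact main_aux hr r 0 (by omega) M hM (fun i hi => by omega)
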